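/- Let U ⊆ ℝⁿ be open, λ ∈ (0,1], σ > 0, and let Λ ⊆ U be relatively closed in U. Let w : U → ℝ be continuous with w ≥ −σ² in U, w ≤ 0 on Λ, and Δw ≥ λ weakly in U ∖ Λ. Let L := 4(2n/λ)^{1/2}σ, let Λ̃ be the union of all closed cubes L(k + [0,1]ⁿ) with k ∈ ℤⁿ that intersect Λ, and let Γ̃ := ∂Λ̃ ∩ U. Then there exists a constant c > 0 depending only on n and λ such that: for every x ∈ Γ̃ and every r > 0 with cl(B_{r + √n·L}(x)) ⊆ U, one has sup over cl(B_r(x)) of w ≥ c r² − 2σ². -/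

import Mathlib

open MeasureTheory Metric Set

/-- The (pointwise) Laplacian of a smooth `f : ℝⁿ → ℝ`. -/
noncomputable def lapl (n : ℕ) (f : EuclideanSpace ℝ (Fin n) → ℝ)
    (x : EuclideanSpace ℝ (Fin n)) : ℝ :=
  ∑ i : Fin n, fderiv ℝ (fun y => fderiv ℝ f y (EuclideanSpace.single i 1)) x
    (EuclideanSpace.single i 1)

/-- `Δw ≥ c` weakly in `V`. -/
def LapGeWeak (n : ℕ) (V : Set (EuclideanSpace ℝ (Fin n)))
    (w : EuclideanSpace ℝ (Fin n) → ℝ) (c : ℝ) : Prop :=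
  ∀ φ : EuclideanSpace ℝ (Fin n) → ℝ, ContDiff ℝ (⊤ : ℕ∞) φ → HasCompactSupport φ →
    tsupport φ ⊆ V → (∀ x, 0 ≤ φ x) →
    c * ∫ x in V, φ x ≤ ∫ x in V, w x * lapl n φ x

/-- The closed lattice cube `L(k + [0,1]ⁿ)` for `k ∈ ℤⁿ`. -/
def latticeCube (n : ℕ) (L : ℝ) (k : Fin n → ℤ) : Set (EuclideanSpace ℝ (Fin n)) :=
  {x | ∀ i, L * (k i : ℝ) ≤ x i ∧ x i ≤ L * (k i : ℝ) + L}

/-- The bulk set: the union of all closed lattice cubes of side `L` meeting `Λ`. -/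
def bulkSet (n : ℕ) (L : ℝ) (Λ : Set (EuclideanSpace ℝ (Fin n))) :
    Set (EuclideanSpace ℝ (Fin n)) :=
  ⋃ (k : Fin n → ℤ) (_ : (latticeCube n L k ∩ Λ).Nonempty), latticeCube n L k


theorem IsLocalMax.deriv_deriv_nonpos {f : ℝ → ℝ} {x : ℝ} (h : IsLocalMax f x)
    (hc : ContinuousAt f x) : deriv (deriv f) x ≤ 0 := by
  by_contra! hpos
  have hmin : IsLocalMin f x := isLocalMin_of_deriv_deriv_pos hpos h.deriv_eq_zero hc
  have heq : f =ᶠ[nhds x] fun _ => f x := by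
    filter_upwards [h, hmin] with y h₁ h₂ using le_antisymm h₁ h₂
  have := heq.deriv.deriv_eq
  simp at this
  linarith

section

variable {n : ℕ}

theorem lapl_le_of_isLocalMax_sub_sq {g : EuclideanSpace ℝ (Fin n) → ℝ} (hg : ContDiff ℝ 2 g)
    {a b : ℝ} {z p y : EuclideanSpace ℝ (Fin n)}
    (hy : IsLocalMax (fun x => g x - (a * ‖x - z‖ ^ 2 + b * ‖x - p‖ ^ 2)) y) :
    lapl n g y ≤ n * (2 * (a + b)) := by
  have key : ∀ i : Fin n, fderiv ℝ (fun y => fderiv ℝ g y (EuclideanSpace.single i 1)) y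
      (EuclideanSpace.single i 1) ≤ 2 * (a + b) := by
    intro i
    set e : EuclideanSpace ℝ (Fin n) := EuclideanSpace.single i 1 with he
    have hline : ∀ t : ℝ, HasDerivAt (fun t : ℝ => y + t • e) e t := fun t => by
      simpa using ((hasDerivAt_id t).smul_const e).const_add y
    have hnorm : ∀ (c : EuclideanSpace ℝ (Fin n)) (t : ℝ),
        ‖y + t • e - c‖ ^ 2 = ‖y - c‖ ^ 2 + 2 * inner ℝ (y - c) e * t + t ^ 2 := by
      intro c t
      rw [add_sub_right_comm, norm_add_sq_real, inner_smul_right, norm_smul, mul_pow]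
      simp [he]
      ring
    have hq : ∀ (c : EuclideanSpace ℝ (Fin n)) (t : ℝ),
        HasDerivAt (fun t : ℝ => ‖y + t • e - c‖ ^ 2) (2 * inner ℝ (y - c) e + 2 * t) t := by
      intro c t
      simp_rw [hnorm]
      simpa using (((hasDerivAt_id t).const_mul (2 * inner ℝ (y - c) e)).const_add
        (‖y - c‖ ^ 2)).fun_add (hasDerivAt_pow 2 t)
    have h1 : ∀ t : ℝ, HasDerivAt
        (fun t : ℝ => g (y + t • e) - (a * ‖y + t • e - z‖ ^ 2 + b * ‖y + t • e - p‖ ^ 2))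
        (fderiv ℝ g (y + t • e) e -
          (a * (2 * inner ℝ (y - z) e + 2 * t) + b * (2 * inner ℝ (y - p) e + 2 * t))) t :=
      fun t => (((hg.differentiable (by norm_num) _).hasFDerivAt.comp_hasDerivAt t (hline t))).sub
        (((hq z t).const_mul a).add ((hq p t).const_mul b))
    have hfd : Differentiable ℝ (fun y => fderiv ℝ g y e) :=
      ((hg.fderiv_right (m := 1) (by norm_num)).clm_apply contDiff_const).differentiable
        (by norm_num)
    have h2 : HasDerivAt (fun t : ℝ => fderiv ℝ g (y + t • e) e -
          (a * (2 * inner ℝ (y - z) e + 2 * t) + b * (2 * inner ℝ (y - p) e + 2 * t)))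
        (fderiv ℝ (fun y => fderiv ℝ g y e) (y + (0 : ℝ) • e) e - (a * 2 + b * 2)) 0 := by
      have hl : ∀ c : ℝ, HasDerivAt (fun t : ℝ => c + 2 * t) 2 0 := fun c => by
        simpa using ((hasDerivAt_id (0 : ℝ)).const_mul 2).const_add c
      exact ((hfd _).hasFDerivAt.comp_hasDerivAt 0 (hline 0)).sub
        (((hl _).const_mul a).add ((hl _).const_mul b))
    have hmax : IsLocalMax
        (fun t : ℝ => g (y + t • e) - (a * ‖y + t • e - z‖ ^ 2 + b * ‖y + t • e - p‖ ^ 2)) 0 := by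
      have hT : Filter.Tendsto (fun t : ℝ => y + t • e) (nhds 0) (nhds y) := by
        simpa using (hline 0).continuousAt.tendsto
      have := hT.eventually hy
      simpa [IsLocalMax, IsMaxFilter] using this
    have := hmax.deriv_deriv_nonpos (h1 0).continuousAt
    rw [funext fun t => (h1 t).deriv, h2.deriv, zero_smul, add_zero] at this
    linarith
  calc lapl n g y ≤ ∑ _i : Fin n, 2 * (a + b) := Finset.sum_le_sum fun i _ => key i
    _ = _ := by simp

open scoped Convolution
open ContinuousLinearMap

theorem fderiv_convolution_lsmul_apply {W ψ : EuclideanSpace ℝ (Fin n) → ℝ}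
    (hW : LocallyIntegrable W volume) (hψ : ContDiff ℝ 1 ψ) (hc : HasCompactSupport ψ)
    (x v : EuclideanSpace ℝ (Fin n)) :
    fderiv ℝ (W ⋆[lsmul ℝ ℝ, volume] ψ) x v
      = (W ⋆[lsmul ℝ ℝ, volume] fun y => fderiv ℝ ψ y v) x := by
  rw [(hc.hasFDerivAt_convolution_right _ hW hψ x).fderiv]
  exact convolution_precompR_apply _ hW (hc.fderiv ℝ) (hψ.continuous_fderiv one_ne_zero) _ _

theorem lapl_convolution {W ψ : EuclideanSpace ℝ (Fin n) → ℝ}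
    (hW : LocallyIntegrable W volume) (hψ : ContDiff ℝ (⊤ : ℕ∞) ψ) (hc : HasCompactSupport ψ)
    (x : EuclideanSpace ℝ (Fin n)) :
    lapl n (W ⋆[lsmul ℝ ℝ, volume] ψ) x = ∫ t, W t * lapl n ψ (x - t) := by
  have hd : ∀ i : Fin n, ContDiff ℝ (⊤ : ℕ∞)
      (fun y => fderiv ℝ ψ y (EuclideanSpace.single i 1)) := fun i =>
    (hψ.fderiv_right (by simp)).clm_apply contDiff_const
  have hdc : ∀ i : Fin n, HasCompactSupport
      (fun y => fderiv ℝ ψ y (EuclideanSpace.single i 1)) := fun i =>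
    hc.fderiv_apply ℝ _
  have hdd : ∀ i : Fin n, ContDiff ℝ (⊤ : ℕ∞)
      (fun y => fderiv ℝ (fun y => fderiv ℝ ψ y (EuclideanSpace.single i 1)) y
        (EuclideanSpace.single i 1)) := fun i =>
    ((hd i).fderiv_right (by simp)).clm_apply contDiff_const
  unfold lapl
  simp_rw [fun y v => fderiv_convolution_lsmul_apply hW (hψ.of_le (by simp)) hc y v]
  simp_rw [fun i y v => fderiv_convolution_lsmul_apply hW ((hd i).of_le (by simp)) (hdc i) y v,
    Finset.mul_sum]
  rw [integral_finsetSum]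
  · rfl
  · intro i _
    exact ((hdc i).fderiv_apply ℝ _).convolutionExists_right (lsmul ℝ ℝ) hW (hdd i).continuous x

theorem lapl_comp_const_sub {ψ : EuclideanSpace ℝ (Fin n) → ℝ} (x t : EuclideanSpace ℝ (Fin n)) :
    lapl n (fun s => ψ (x - s)) t = lapl n ψ (x - t) := by
  have h : ∀ (f : EuclideanSpace ℝ (Fin n) → ℝ) t v,
      fderiv ℝ (fun s => f (x - s)) t v = - fderiv ℝ f (x - t) v := by
    intro f t v
    have := (ContinuousLinearEquiv.neg ℝ).comp_right_fderiv (f := fun s => f (x + s)) (x := t)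
    rw [fderiv_comp_add_left] at this
    simpa [Function.comp_def, sub_eq_add_neg] using DFunLike.congr_fun this v
  unfold lapl
  simp_rw [h, fderiv_fun_neg]
  refine Finset.sum_congr rfl fun i _ => ?_
  rw [neg_apply, h (fun y => fderiv ℝ ψ y _), neg_neg]

/-- Mollifying `w` with `Δw ≥ lam` weakly gives `Δ ≥ lam` pointwise, away from the boundary. -/
theorem LapGeWeak.le_lapl_convolution {V : Set (EuclideanSpace ℝ (Fin n))}
    {w : EuclideanSpace ℝ (Fin n) → ℝ} {lam : ℝ} (h : LapGeWeak n V w lam)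
    {K : Set (EuclideanSpace ℝ (Fin n))} (hW : LocallyIntegrable (K.indicator w) volume)
    (hKV : K ⊆ V) (ψ : ContDiffBump (0 : EuclideanSpace ℝ (Fin n)))
    {x : EuclideanSpace ℝ (Fin n)} (hx : closedBall x ψ.rOut ⊆ K) :
    lam ≤ lapl n (K.indicator w ⋆[lsmul ℝ ℝ, volume] ψ.normed volume) x := by
  have hψ : ContDiff ℝ (⊤ : ℕ∞) (ψ.normed volume) := ψ.contDiff_normed
  have hcont : ContDiff ℝ (⊤ : ℕ∞) (fun t => ψ.normed volume (x - t)) :=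
    hψ.comp (contDiff_const.sub contDiff_id)
  have hts : tsupport (fun t => ψ.normed volume (x - t)) ⊆ closedBall x ψ.rOut := by
    refine closure_minimal (fun t ht => ?_) isClosed_closedBall
    have : x - t ∈ Function.support (ψ.normed volume) := ht
    rw [ψ.support_normed_eq, mem_ball_zero_iff] at this
    rw [mem_closedBall, dist_comm, dist_eq_norm]
    exact this.le
  have hzero : ∀ t ∉ K, ψ.normed volume (x - t) = 0 := fun t ht =>
    image_eq_zero_of_notMem_tsupport (f := fun t => ψ.normed volume (x - t))
      fun h' => ht (hx (hts h'))
  have hlzero : ∀ t ∉ K, lapl n (ψ.normed volume) (x - t) = 0 := fun t ht => by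
    rw [← lapl_comp_const_sub]
    have ht' : t ∉ tsupport (fun t => ψ.normed volume (x - t)) := fun h' => ht (hx (hts h'))
    refine Finset.sum_eq_zero fun i _ => ?_
    have : t ∉ tsupport (fun y => fderiv ℝ (fun t => ψ.normed volume (x - t)) y
        (EuclideanSpace.single i 1)) := fun h' => ht' (tsupport_fderiv_apply_subset ℝ _ h')
    rw [image_eq_zero_of_notMem_tsupport fun h' => this (tsupport_fderiv_subset ℝ h')]
    rfl
  have key := h (fun t => ψ.normed volume (x - t)) hcont
    (HasCompactSupport.of_support_subset_isCompact (isCompact_closedBall x ψ.rOut)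
      (subset_closure.trans hts)) ((hts.trans hx).trans hKV) (fun t => ψ.nonneg_normed _)
  rw [setIntegral_eq_integral_of_forall_compl_eq_zero fun t ht => hzero t fun h' => ht (hKV h'),
    integral_sub_left_eq_self (fun t => ψ.normed volume t) volume x, ψ.integral_normed,
    mul_one, setIntegral_eq_integral_of_forall_compl_eq_zero fun t ht => by
      rw [lapl_comp_const_sub, hlzero t fun h' => ht (hKV h'), mul_zero]] at key
  rw [lapl_convolution hW hψ ψ.hasCompactSupport_normed]
  refine key.trans_eq (integral_congr_ae (.of_forall fun t => ?_))
  simp only [lapl_comp_const_sub]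
  by_cases ht : t ∈ K
  · rw [indicator_of_mem ht]
  · rw [hlzero t ht, mul_zero, mul_zero]

/-- Weak maximum principle: `y ↦ w y - a * ‖y - z‖ ^ 2` has no local maximum when `2 * n * a < lam`. -/
theorem LapGeWeak.exists_lt_sub_sq {V : Set (EuclideanSpace ℝ (Fin n))}
    {w : EuclideanSpace ℝ (Fin n) → ℝ} {lam : ℝ} (h : LapGeWeak n V w lam)
    {p : EuclideanSpace ℝ (Fin n)} {s : ℝ} (hs : 0 < s) (hpV : closedBall p (2 * s) ⊆ V)
    (hw : ContinuousOn w (closedBall p (2 * s))) {a : ℝ} (ha : 2 * n * a < lam)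
    (z : EuclideanSpace ℝ (Fin n)) :
    ∃ y ∈ closedBall p s, w p - a * ‖p - z‖ ^ 2 < w y - a * ‖y - z‖ ^ 2 := by
  by_contra! hmax
  obtain ⟨b, hb, hb'⟩ : ∃ b > 0, n * (2 * (a + b)) < lam := by
    refine ⟨(lam - 2 * n * a) / (2 * (n + 1)), by have := sub_pos.2 ha; positivity, ?_⟩
    have h1 : (lam - 2 * n * a) / (2 * (n + 1)) * (2 * (n + 1)) = lam - 2 * n * a :=
      div_mul_cancel₀ _ (by positivity)
    have h2 : 0 < (lam - 2 * n * a) / (2 * (n + 1)) := by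
      have := sub_pos.2 ha; positivity
    linarith
  set K := closedBall p (2 * s) with hK
  have hKc : IsCompact K := isCompact_closedBall _ _
  have hW : Integrable (K.indicator w) volume :=
    (hw.integrableOn_compact hKc).integrable_indicator measurableSet_closedBall
  set δ := b * s ^ 2 / 4 with hδ
  have hδ0 : 0 < δ := by positivity
  obtain ⟨ε, hε, hunif⟩ :=
    Metric.uniformContinuousOn_iff.1 (hKc.uniformContinuousOn_of_continuous hw) δ hδ0
  have hρ : 0 < min ε s := lt_min hε hs
  let ψ : ContDiffBump (0 : EuclideanSpace ℝ (Fin n)) :=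
    ⟨min ε s / 2, min ε s, half_pos hρ, half_lt_self hρ⟩
  have hball : ∀ y ∈ closedBall p s, closedBall y ψ.rOut ⊆ K := fun y hy =>
    closedBall_subset_closedBall' (by
      have h1 : ψ.rOut ≤ s := min_le_right _ _
      have h2 := mem_closedBall.1 hy
      linarith)
  set g := K.indicator w ⋆[lsmul ℝ ℝ, volume] ψ.normed volume with hg
  have hgs : ContDiff ℝ 2 g :=
    (ψ.hasCompactSupport_normed.contDiff_convolution_right (n := 2) _ hW.locallyIntegrable
      ψ.contDiff_normed)
  have hsK : closedBall p s ⊆ K := closedBall_subset_closedBall (by linarith)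
  have happ : ∀ y ∈ closedBall p s, |g y - w y| ≤ δ := by
    intro y hy
    have h1 := ψ.dist_normed_convolution_le (x₀ := y) (ε := δ) hW.aestronglyMeasurable
      fun x hx => by
        have hxK := hball y hy (ball_subset_closedBall hx)
        rw [indicator_of_mem hxK, indicator_of_mem (hsK hy)]
        exact (hunif x hxK y (hsK hy) (lt_of_lt_of_le hx (min_le_left _ _))).le
    rw [indicator_of_mem (hsK hy), Real.dist_eq] at h1
    convert h1 using 3
    rw [hg, convolution_lsmul_swap, convolution_lsmul]
    simp_rw [smul_eq_mul]
    refine integral_congr_ae (.of_forall fun t => mul_comm _ _)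
  obtain ⟨y, hy, hymax⟩ := (isCompact_closedBall p s).exists_isMaxOn (nonempty_closedBall.2 hs.le)
    (f := fun x => g x - (a * ‖x - z‖ ^ 2 + b * ‖x - p‖ ^ 2)) (by
      have := hgs.continuous
      fun_prop)
  have hyp := hymax (mem_closedBall_self hs.le)
  have hyb : y ∈ ball p s := by
    rw [mem_ball]
    refine lt_of_le_of_ne hy fun heq => ?_
    have h1 := abs_le.1 (happ y hy)
    have h2 := abs_le.1 (happ p (mem_closedBall_self hs.le))
    have h3 := hmax y hy
    simp only [mem_ofPred_eq, sub_self, norm_zero, ← dist_eq_norm y p, heq] at hyp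
    nlinarith
  have hloc := hymax.isLocalMax (Filter.mem_of_superset (isOpen_ball.mem_nhds hyb)
    ball_subset_closedBall)
  have := lapl_le_of_isLocalMax_sub_sq hgs hloc
  have := h.le_lapl_convolution hW.locallyIntegrable hpV ψ (hball y hy)
  linarith

/-- Quadratic growth away from `Λ`, starting from a point above the values of `w` on `Λ`. -/
theorem LapGeWeak.exists_growth {U Λ : Set (EuclideanSpace ℝ (Fin n))} (hU : IsOpen U)
    (hΛ : closure Λ ∩ U ⊆ Λ) {w : EuclideanSpace ℝ (Fin n) → ℝ} (hw : ContinuousOn w U) {lam : ℝ}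
    (hn : 0 < n) (h : LapGeWeak n (U \ Λ) w lam)
    {z : EuclideanSpace ℝ (Fin n)} {ρ : ℝ} (hρ : 0 < ρ)
    (hz : closedBall z ρ ⊆ U) (hzΛ : ∀ y ∈ Λ ∩ closedBall z ρ, w y < w z) :
    ∃ y ∈ closedBall z ρ, w z + lam / (2 * n) * ρ ^ 2 ≤ w y := by
  by_contra! hlt
  have hcomp := isCompact_closedBall z ρ
  have hzmem := mem_closedBall_self (x := z) hρ.le
  obtain ⟨y₀, hy₀, hy₀max⟩ := hcomp.exists_isMaxOn ⟨z, hzmem⟩ (hw.mono hz)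
  have hn' : (0 : ℝ) < n := by exact_mod_cast hn
  obtain ⟨a, ha, ha'⟩ : ∃ a, (w y₀ - w z) / ρ ^ 2 < a ∧ a < lam / (2 * n) := by
    refine exists_between ?_
    rw [div_lt_iff₀ (by positivity)]
    linarith [hlt y₀ hy₀]
  have hzy : w z ≤ w y₀ := hy₀max hzmem
  have ha0 : 0 < a := lt_of_le_of_lt (div_nonneg (sub_nonneg.2 hzy) (by positivity)) ha
  rw [div_lt_iff₀ (by positivity)] at ha
  rw [lt_div_iff₀ (by positivity)] at ha'
  obtain ⟨p, hp, hpmax⟩ := hcomp.exists_isMaxOn ⟨z, hzmem⟩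
    (f := fun y => w y - a * ‖y - z‖ ^ 2) ((hw.mono hz).sub (by fun_prop))
  have hpz : w z ≤ w p - a * ‖p - z‖ ^ 2 := by simpa using hpmax hzmem
  have hpb : p ∈ ball z ρ := by
    refine mem_ball.2 (lt_of_le_of_ne (mem_closedBall.1 hp) fun heq => ?_)
    rw [← dist_eq_norm, heq] at hpz
    have : w p ≤ w y₀ := hy₀max hp
    linarith
  have hpΛ : p ∉ Λ := fun hmem => by
    have := hzΛ p ⟨hmem, hp⟩
    nlinarith [sq_nonneg ‖p - z‖]
  have hopen : IsOpen (ball z ρ ∩ (U \ Λ)) := by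
    have : U \ Λ = U ∩ (closure Λ)ᶜ := by
      ext x
      exact ⟨fun hx => ⟨hx.1, fun hc => hx.2 (hΛ ⟨hc, hx.1⟩)⟩,
        fun hx => ⟨hx.1, fun hc => hx.2 (subset_closure hc)⟩⟩
    rw [this]
    exact isOpen_ball.inter (hU.inter isClosed_closure.isOpen_compl)
  obtain ⟨t, ht, htsub⟩ := Metric.nhds_basis_closedBall.mem_iff.1
    (hopen.mem_nhds ⟨hpb, hz hp, hpΛ⟩)
  have h2 : closedBall p (2 * (t / 2)) ⊆ ball z ρ ∩ (U \ Λ) := by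
    rwa [mul_div_cancel₀ _ (two_ne_zero' ℝ)]
  obtain ⟨y, hy, hylt⟩ := h.exists_lt_sub_sq (half_pos ht) (h2.trans inter_subset_right)
    (hw.mono fun x hx => (h2 hx).2.1) (a := a) (by linarith) z
  have hyb : y ∈ closedBall z ρ := ball_subset_closedBall
    (h2 (closedBall_subset_closedBall (by linarith) hy)).1
  exact absurd (hpmax hyb) (not_le.2 hylt)

theorem exists_mem_latticeCube {L : ℝ} (hL : 0 < L) (x : EuclideanSpace ℝ (Fin n)) :
    ∃ k, x ∈ latticeCube n L k := by
  refine ⟨fun i => ⌊x i / L⌋, fun i => ?_⟩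
  have h1 := Int.floor_le (x i / L)
  have h2 := (Int.lt_floor_add_one (x i / L)).le
  rw [le_div_iff₀ hL] at h1
  rw [div_le_iff₀ hL] at h2
  constructor <;> linarith

theorem dist_le_of_mem_latticeCube {L : ℝ} (hL : 0 ≤ L) {k : Fin n → ℤ}
    {x y : EuclideanSpace ℝ (Fin n)} (hx : x ∈ latticeCube n L k) (hy : y ∈ latticeCube n L k) :
    dist x y ≤ √n * L := by
  rw [EuclideanSpace.dist_eq]
  refine Real.sqrt_le_iff.2 ⟨by positivity, ?_⟩
  calc ∑ i, dist (x i) (y i) ^ 2 ≤ ∑ _i : Fin n, L ^ 2 := by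
        refine Finset.sum_le_sum fun i _ => pow_le_pow_left₀ dist_nonneg ?_ 2
        rw [Real.dist_eq, abs_le]
        constructor <;> linarith [(hx i).1, (hx i).2, (hy i).1, (hy i).2]
    _ = (√n * L) ^ 2 := by rw [mul_pow, Real.sq_sqrt n.cast_nonneg]; simp

theorem exists_closedBall_subset_latticeCube (L : ℝ) (k : Fin n → ℤ) :
    ∃ z, closedBall z (L / 2) ⊆ latticeCube n L k := by
  refine ⟨WithLp.toLp 2 fun i => L * k i + L / 2, fun y hy i => ?_⟩
  rw [mem_closedBall, dist_eq_norm] at hy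
  have := (PiLp.norm_apply_le _ i).trans hy
  rw [Real.norm_eq_abs, abs_le] at this
  simp only [PiLp.sub_apply] at this
  constructor <;> linarith

end

/-- **Non-degeneracy at the bulk free boundary (Corollary 4.1).**  There is
`c = c(n,λ) > 0` such that for every relatively closed `Λ ⊆ U` and continuous `w`
with `w ≥ -σ²` in `U`, `w ≤ 0` on `Λ`, `Δw ≥ λ` weakly in `U ∖ Λ`, every point `x`
of the bulk free boundary `Γ̃ = ∂Λ̃ ∩ U` (with cube side `L = 4(2n/λ)^{1/2}σ`) and
every `r > 0` with `cl(B_{r+√n L}(x)) ⊆ U` satisfy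
`sup_{cl(B_r(x))} w ≥ c r² - 2σ²`. -/
theorem bulk_nondegeneracy (n : ℕ) (lam : ℝ) (hlam : lam ∈ Set.Ioc (0:ℝ) 1) :
    ∃ c > 0, ∀ U : Set (EuclideanSpace ℝ (Fin n)), IsOpen U →
      ∀ σ : ℝ, 0 < σ →
      ∀ Λ : Set (EuclideanSpace ℝ (Fin n)), Λ ⊆ U → closure Λ ∩ U ⊆ Λ →
      ∀ w : EuclideanSpace ℝ (Fin n) → ℝ, ContinuousOn w U →
        (∀ x ∈ U, -σ ^ 2 ≤ w x) → (∀ x ∈ Λ, w x ≤ 0) →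
        LapGeWeak n (U \ Λ) w lam →
      ∀ x ∈ frontier (bulkSet n (4 * Real.sqrt (2 * n / lam) * σ) Λ) ∩ U,
      ∀ r : ℝ, 0 < r →
        closedBall x (r + Real.sqrt n * (4 * Real.sqrt (2 * n / lam) * σ)) ⊆ U →
        c * r ^ 2 - 2 * σ ^ 2 ≤ sSup (w '' closedBall x r) := by
  have hlam0 := hlam.1
  rcases Nat.eq_zero_or_pos n with rfl | hn
  · refine ⟨1, one_pos, fun U _ σ _ Λ _ _ w _ _ _ _ x hx => ?_⟩
    rw [(isClopen_discrete _).frontier_eq] at hx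
    exact hx.1.elim
  have hn1 : (1 : ℝ) ≤ n := by exact_mod_cast hn
  refine ⟨lam / (128 * n ^ 2), by positivity, ?_⟩
  intro U hU σ hσ Λ _ hΛ w hw hlow hwΛ hΔ x hx r hr hxU
  set L := 4 * √(2 * n / lam) * σ with hLdef
  have hL : 0 < L := by positivity
  have hL2 : lam * L ^ 2 = 32 * n * σ ^ 2 := by
    rw [hLdef, mul_pow, mul_pow, Real.sq_sqrt (by positivity)]
    field_simp
    norm_num
  have hnL : 0 ≤ √n * L := by positivity
  have hnL2 : lam * (√n * L) ^ 2 = 32 * n ^ 2 * σ ^ 2 := by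
    rw [mul_pow, Real.sq_sqrt n.cast_nonneg]
    linear_combination (n : ℝ) * hL2
  have hrU : closedBall x r ⊆ U := (closedBall_subset_closedBall (by linarith)).trans hxU
  have hbdd : BddAbove (w '' closedBall x r) :=
    ((isCompact_closedBall x r).image_of_continuousOn (hw.mono hrU)).bddAbove
  suffices ∃ y ∈ closedBall x r, lam / (128 * n ^ 2) * r ^ 2 - 2 * σ ^ 2 ≤ w y by
    obtain ⟨y, hy, hle⟩ := this
    exact hle.trans (le_csSup hbdd (mem_image_of_mem w hy))
  rcases lt_or_ge r (2 * (√n * L)) with hsmall | hbig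
  · refine ⟨x, mem_closedBall_self hr.le, ?_⟩
    have : lam / (128 * n ^ 2) * r ^ 2 ≤ σ ^ 2 := by
      rw [div_mul_eq_mul_div, div_le_iff₀ (by positivity)]
      calc lam * r ^ 2 ≤ lam * (2 * (√n * L)) ^ 2 := by gcongr
        _ = σ ^ 2 * (128 * n ^ 2) := by linear_combination 4 * hnL2
    linarith [hlow x hx.2]
  obtain ⟨y, hyx, hy⟩ : ∃ y ∈ ball x (r / 4), y ∉ bulkSet n L Λ := by
    by_contra! hsub
    exact hx.1.2 (mem_interior.2 ⟨_, hsub, isOpen_ball, mem_ball_self (by positivity)⟩)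
  obtain ⟨k, hk⟩ := exists_mem_latticeCube hL y
  have hkΛ : ∀ q ∈ latticeCube n L k, q ∉ Λ := fun q hq hqΛ =>
    hy (mem_biUnion (x := k) ⟨q, hq, hqΛ⟩ hk)
  have hkx : ∀ q ∈ latticeCube n L k, dist q x ≤ 3 / 4 * r := fun q hq => by
    have h1 := dist_le_of_mem_latticeCube hL.le hq hk
    have h2 := mem_ball.1 hyx
    linarith [dist_triangle q y x]
  have hkU : latticeCube n L k ⊆ U := fun q hq =>
    hrU (mem_closedBall.2 ((hkx q hq).trans (by linarith)))
  obtain ⟨z, hz⟩ := exists_closedBall_subset_latticeCube L k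
  obtain ⟨z', hz', hzz'⟩ := hΔ.exists_growth hU hΛ hw hn (half_pos hL) (hz.trans hkU)
    fun q hq => (hkΛ q (hz hq.2) hq.1).elim
  have hwz' : 3 * σ ^ 2 ≤ w z' := by
    have h1 : lam / (2 * n) * (L / 2) ^ 2 = 4 * σ ^ 2 := by
      field_simp
      linear_combination hL2
    linarith [hlow z (hkU (hz (mem_closedBall_self (half_pos hL).le)))]
  have hsub : closedBall z' (r / 4) ⊆ closedBall x r :=
    closedBall_subset_closedBall' (by linarith [hkx z' (hz hz')])
  have hσ2 : 0 < σ ^ 2 := by positivity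
  obtain ⟨q, hq, hqw⟩ := hΔ.exists_growth hU hΛ hw hn (by positivity : 0 < r / 4)
    (hsub.trans hrU) fun q hq => (hwΛ q hq.1).trans_lt (by linarith)
  refine ⟨q, hsub hq, ?_⟩
  have : lam / (128 * n ^ 2) * r ^ 2 ≤ lam / (2 * n) * (r / 4) ^ 2 := by
    calc lam / (128 * n ^ 2) * r ^ 2 ≤ lam / (32 * n) * r ^ 2 := by
          gcongr <;> nlinarith
      _ = _ := by field_simp; norm_num
  linarith
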